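/- arXiv:1711.00115 — 2 statements merged into one kernel-verified Lean document; each statement's English description precedes it below -/
import Mathlib

section
/- There exists a *-homomorphism Δ̃ : M(A) → M(D) extending Δ, i.e. satisfying Δ̃(ι(a)) = Δ(a) for all a ∈ A and Δ̃(1) = E, where 1 is the unit of M(A). (Existence part of Proposition 3.3(4) of the paper.) -/
open scoped MultiplierAlgebra
open Filter Topology

theorem CStarAlgebra.exists_isApproximateUnit (A : Type*) [NonUnitalCStarAlgebra A] :
    ∃ l : Filter A, l.IsApproximateUnit ∧ ∀ᶠ e in l, ‖e‖ ≤ 1 := by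
  let := CStarAlgebra.spectralOrder A
  have := CStarAlgebra.spectralOrderedRing A
  have h := CStarAlgebra.increasingApproximateUnit A
  exact ⟨_, h.toIsApproximateUnit, h.eventually_norm⟩

/-- For an eventually bounded family of operators into a Banach space, the set of points of
convergence is a closed subspace. -/
theorem ContinuousLinearMap.exists_tendsto_of_mem_closure_span {𝕜 V W ι : Type*}
    [NontriviallyNormedField 𝕜] [NormedAddCommGroup V] [NormedSpace 𝕜 V] [NormedAddCommGroup W]
    [NormedSpace 𝕜 W] [CompleteSpace W] {l : Filter ι} [l.NeBot] {F : ι → V →L[𝕜] W} {C : ℝ}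
    (hC : ∀ᶠ i in l, ‖F i‖ ≤ C) {s : Set V}
    (hs : ∀ x ∈ s, ∃ y, Tendsto (fun i ↦ F i x) l (𝓝 y)) {x : V}
    (hx : x ∈ closure (Submodule.span 𝕜 s : Set V)) :
    ∃ y, Tendsto (fun i ↦ F i x) l (𝓝 y) := by
  have hspan : ∀ z ∈ Submodule.span 𝕜 s, ∃ y, Tendsto (fun i ↦ F i z) l (𝓝 y) := by
    intro z hz
    induction hz using Submodule.span_induction with
    | mem z hz => exact hs z hz
    | zero => exact ⟨0, by simp⟩
    | add z w _ _ hz hw =>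
      obtain ⟨y, hy⟩ := hz
      obtain ⟨y', hy'⟩ := hw
      exact ⟨y + y', by simpa using hy.add hy'⟩
    | smul c z _ hz =>
      obtain ⟨y, hy⟩ := hz
      exact ⟨c • y, by simpa using hy.const_smul c⟩
  apply CompleteSpace.complete (f := map (fun i ↦ F i x) l)
  rw [Metric.cauchy_iff]
  refine ⟨inferInstance, fun ε hε ↦ ?_⟩
  have hC' : 0 < |C| + 1 := by positivity
  obtain ⟨z, hz, hxz⟩ := Metric.mem_closure_iff.1 hx (ε / 4 / (|C| + 1)) (by positivity)
  obtain ⟨y, hy⟩ := hspan z hz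
  have hnear : ∀ᶠ i in l, dist (F i x) y < ε / 2 := by
    filter_upwards [hC, Metric.tendsto_nhds.1 hy (ε / 4) (by positivity)] with i hi hiy
    have h : dist (F i x) (F i z) < ε / 4 := by
      rw [dist_eq_norm, ← map_sub]
      calc ‖F i (x - z)‖ ≤ (|C| + 1) * ‖x - z‖ :=
            (F i).le_of_opNorm_le (by linarith [le_abs_self C]) _
        _ < ε / 4 := by
            rw [dist_eq_norm, lt_div_iff₀ hC'] at hxz
            linarith
    linarith [dist_triangle (F i x) (F i z) y]
  refine ⟨Metric.ball y (ε / 2), hnear, fun u hu v hv ↦ ?_⟩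
  rw [Metric.mem_ball] at hu hv
  linarith [dist_triangle_right u v y]

/-- An eventually bounded, pointwise convergent family of operators has a bounded limit. -/
theorem ContinuousLinearMap.exists_tendsto_apply {𝕜 V W ι : Type*}
    [NontriviallyNormedField 𝕜] [NormedAddCommGroup V] [NormedSpace 𝕜 V] [NormedAddCommGroup W]
    [NormedSpace 𝕜 W] {l : Filter ι} [l.NeBot] {F : ι → V →L[𝕜] W} {C : ℝ}
    (hC : ∀ᶠ i in l, ‖F i‖ ≤ C) (h : ∀ x, ∃ y, Tendsto (fun i ↦ F i x) l (𝓝 y)) :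
    ∃ T : V →L[𝕜] W, ∀ x, Tendsto (fun i ↦ F i x) l (𝓝 (T x)) := by
  choose T hT using h
  refine ⟨(linearMapOfTendsto T (fun i ↦ (F i : V →ₗ[𝕜] W))
    (tendsto_pi_nhds.2 hT)).mkContinuous C fun x ↦ ?_, hT⟩
  refine le_of_tendsto (hT x).norm ?_
  filter_upwards [hC] with i hi using (F i).le_of_opNorm_le hi x

namespace DoubleCentralizer

section

variable {A : Type*} [NonUnitalCStarAlgebra A]

theorem ext_fst {a b : 𝓜(ℂ, A)} (h : ∀ x, a.fst x = b.fst x) : a = b := by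
  rw [← sub_eq_zero, ← norm_eq_zero, ← norm_fst, sub_fst, norm_eq_zero, sub_eq_zero]
  exact ContinuousLinearMap.ext h

theorem ext_snd {a b : 𝓜(ℂ, A)} (h : ∀ x, a.snd x = b.snd x) : a = b := by
  rw [← sub_eq_zero, ← norm_eq_zero, ← norm_snd, sub_snd, norm_eq_zero, sub_eq_zero]
  exact ContinuousLinearMap.ext h

theorem mul_coe (m : 𝓜(ℂ, A)) (a : A) : m * (a : 𝓜(ℂ, A)) = (m.fst a : A) :=
  ext_snd fun x ↦ m.central x a

theorem coe_mul (m : 𝓜(ℂ, A)) (a : A) : (a : 𝓜(ℂ, A)) * m = (m.snd a : A) :=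
  ext_fst fun x ↦ (m.central a x).symm

theorem fst_mul (m : 𝓜(ℂ, A)) (a b : A) : m.fst (a * b) = m.fst a * b :=
  congrArg (fun T ↦ T.fst b) (mul_coe m a)

theorem snd_mul (m : 𝓜(ℂ, A)) (a b : A) : m.snd (a * b) = a * m.snd b :=
  congrArg (fun T ↦ T.snd a) (coe_mul m b)

theorem continuous_fst_apply (x : A) : Continuous fun m : 𝓜(ℂ, A) ↦ m.fst x :=
  AddMonoidHomClass.continuous_of_bound
    (AddMonoidHom.mk' (fun m : 𝓜(ℂ, A) ↦ m.fst x) fun _ _ ↦ rfl) ‖x‖ fun m ↦ by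
      simpa [norm_fst, mul_comm] using m.fst.le_opNorm x

theorem continuous_snd_apply (x : A) : Continuous fun m : 𝓜(ℂ, A) ↦ m.snd x :=
  AddMonoidHomClass.continuous_of_bound
    (AddMonoidHom.mk' (fun m : 𝓜(ℂ, A) ↦ m.snd x) fun _ _ ↦ rfl) ‖x‖ fun m ↦ by
      simpa [norm_snd, mul_comm] using m.snd.le_opNorm x

/-- An eventually bounded family of multipliers that converges strictly pointwise has a strict
limit. -/
theorem exists_strict_limit {ι : Type*} {l : Filter ι} [l.NeBot] {F : ι → 𝓜(ℂ, A)} {C : ℝ}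
    (hC : ∀ᶠ i in l, ‖F i‖ ≤ C) (hfst : ∀ x, ∃ y, Tendsto (fun i ↦ (F i).fst x) l (𝓝 y))
    (hsnd : ∀ x, ∃ y, Tendsto (fun i ↦ (F i).snd x) l (𝓝 y)) :
    ∃ T : 𝓜(ℂ, A), (∀ x, Tendsto (fun i ↦ (F i).fst x) l (𝓝 (T.fst x))) ∧
      ∀ x, Tendsto (fun i ↦ (F i).snd x) l (𝓝 (T.snd x)) := by
  obtain ⟨L, hL⟩ := ContinuousLinearMap.exists_tendsto_apply
    (hC.mono fun i hi ↦ (norm_fst (F i)).trans_le hi) hfst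
  obtain ⟨R, hR⟩ := ContinuousLinearMap.exists_tendsto_apply
    (hC.mono fun i hi ↦ (norm_snd (F i)).trans_le hi) hsnd
  refine ⟨⟨(L, R), fun x y ↦ ?_⟩, hL, hR⟩
  refine tendsto_nhds_unique ((hR x).mul_const y) ?_
  simpa only [(F _).central] using (hL y).const_mul x

end

section

variable {A D : Type*} [NonUnitalCStarAlgebra A] [NonUnitalCStarAlgebra D]
  {Δ : A →⋆ₙₐ[ℂ] 𝓜(ℂ, D)} {E : 𝓜(ℂ, D)}

/-- The value at `m` of the extension of `Δ` to multipliers, as the strict limit of `Δ (m e)`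
along an approximate unit. -/
theorem exists_extension_apply (hEΔ : ∀ a, E * Δ a = Δ a) (hΔE : ∀ a, Δ a * E = Δ a)
    (hL : ∀ x, E.fst x ∈
      closure (Submodule.span ℂ {y : D | ∃ (a : A) (x : D), (Δ a).fst x = y} : Set D))
    (hR : ∀ x, E.snd x ∈
      closure (Submodule.span ℂ {y : D | ∃ (a : A) (x : D), (Δ a).snd x = y} : Set D))
    (m : 𝓜(ℂ, A)) :
    ∃ T : 𝓜(ℂ, D), (∀ a, T * Δ a = Δ (m.fst a)) ∧ (∀ a, Δ a * T = Δ (m.snd a)) ∧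
      T * E = T ∧ E * T = T := by
  obtain ⟨l, hl, hl_norm⟩ := CStarAlgebra.exists_isApproximateUnit A
  have := hl.neBot
  have hΔ : Continuous Δ :=
    AddMonoidHomClass.continuous_of_bound Δ 1 fun a ↦ by
      simpa using NonUnitalStarAlgHom.norm_apply_le Δ a
  have hC : ∀ᶠ e in l, ‖Δ (m.fst e)‖ ≤ ‖m‖ := by
    filter_upwards [hl_norm] with e he
    refine (NonUnitalStarAlgHom.norm_apply_le Δ _).trans ?_
    simpa [norm_fst] using m.fst.le_opNorm_of_le he
  have hfst (a : A) (z : D) :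
      Tendsto (fun e ↦ (Δ (m.fst e)).fst ((Δ a).fst z)) l (𝓝 ((Δ (m.fst a)).fst z)) := by
    have h : Continuous fun b : A ↦ (Δ (m.fst b)).fst z :=
      (continuous_fst_apply z).comp (hΔ.comp m.fst.continuous)
    refine ((h.tendsto a).comp (hl.tendsto_mul_right a)).congr fun e ↦ ?_
    simp [fst_mul]
  have hsnd (a : A) (z : D) :
      Tendsto (fun e ↦ (Δ (m.fst e)).snd ((Δ a).snd z)) l (𝓝 ((Δ (m.snd a)).snd z)) := by
    have h : Continuous fun b : A ↦ (Δ b).snd z :=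
      (continuous_snd_apply z).comp hΔ
    refine ((h.tendsto _).comp (hl.tendsto_mul_left (m.snd a))).congr fun e ↦ ?_
    simp [m.central]
  have hfstE (a : A) (x : D) : (Δ a).fst (E.fst x) = (Δ a).fst x :=
    congrArg (fun T ↦ T.fst x) (hΔE a)
  have hsndE (a : A) (x : D) : (Δ a).snd (E.snd x) = (Δ a).snd x :=
    congrArg (fun T ↦ T.snd x) (hEΔ a)
  have hfst_lim (x : D) : ∃ y, Tendsto (fun e ↦ (Δ (m.fst e)).fst x) l (𝓝 y) := by
    have h := ContinuousLinearMap.exists_tendsto_of_mem_closure_span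
      (F := fun e ↦ (Δ (m.fst e)).fst) (hC.mono fun e he ↦ (norm_fst (Δ (m.fst e))).trans_le he)
      (by rintro _ ⟨a, z, rfl⟩; exact ⟨_, hfst a z⟩) (hL x)
    simpa only [hfstE] using h
  have hsnd_lim (x : D) : ∃ y, Tendsto (fun e ↦ (Δ (m.fst e)).snd x) l (𝓝 y) := by
    have h := ContinuousLinearMap.exists_tendsto_of_mem_closure_span
      (F := fun e ↦ (Δ (m.fst e)).snd) (hC.mono fun e he ↦ (norm_snd (Δ (m.fst e))).trans_le he)
      (by rintro _ ⟨a, z, rfl⟩; exact ⟨_, hsnd a z⟩) (hR x)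
    simpa only [hsndE] using h
  obtain ⟨T, hTL, hTR⟩ := exists_strict_limit hC hfst_lim hsnd_lim
  refine ⟨T, fun a ↦ ext_fst fun z ↦ ?_, fun a ↦ ext_snd fun z ↦ ?_, ext_fst fun x ↦ ?_,
    ext_snd fun x ↦ ?_⟩
  · exact tendsto_nhds_unique (hTL ((Δ a).fst z)) (hfst a z)
  · exact tendsto_nhds_unique (hTR ((Δ a).snd z)) (hsnd a z)
  · refine tendsto_nhds_unique (hTL (E.fst x)) ?_
    simpa only [hfstE] using hTL x
  · refine tendsto_nhds_unique (hTR (E.snd x)) ?_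
    simpa only [hsndE] using hTR x

/-- A multiplier supported on `E` is determined by its products with the range of `Δ`. -/
theorem eq_of_mul_apply_eq
    (hL : ∀ x, E.fst x ∈
      closure (Submodule.span ℂ {y : D | ∃ (a : A) (x : D), (Δ a).fst x = y} : Set D))
    {S T : 𝓜(ℂ, D)} (hS : S * E = S) (hT : T * E = T) (h : ∀ a, S * Δ a = T * Δ a) : S = T := by
  rw [← hS, ← hT]
  refine ext_fst fun x ↦ ?_
  refine closure_minimal (fun y hy ↦ ?_) (isClosed_eq S.fst.continuous T.fst.continuous) (hL x)
  refine LinearMap.eqOn_span (f := S.fst.toLinearMap) (g := T.fst.toLinearMap) ?_ hy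
  rintro _ ⟨a, z, rfl⟩
  exact congrArg (fun T ↦ T.fst z) (h a)

end

end DoubleCentralizer

open DoubleCentralizer in
/-- Proposition 3.3(4), existence part: `Δ` extends to a *-homomorphism
`Δ̃ : M(A) → M(D)` with `Δ̃(ι(a)) = Δ(a)` for all `a ∈ A` and `Δ̃(1) = E`. -/
theorem comultiplication_extends_to_multiplier_algebra
    {A D : Type*} [NonUnitalCStarAlgebra A] [NonUnitalCStarAlgebra D]
    (Δ : A →⋆ₙₐ[ℂ] 𝓜(ℂ, D)) (E : 𝓜(ℂ, D))
    (hE_star : star E = E) (hE_idem : E * E = E)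
    (hE_left : closure (Submodule.span ℂ {y : D | ∃ (a : A) (x : D), (Δ a).fst x = y} : Set D)
      = {y : D | ∃ x : D, E.fst x = y})
    (hE_right : closure (Submodule.span ℂ {y : D | ∃ (a : A) (x : D), (Δ a).snd x = y} : Set D)
      = {y : D | ∃ x : D, E.snd x = y}) :
    ∃ Δext : 𝓜(ℂ, A) →⋆ₙₐ[ℂ] 𝓜(ℂ, D),
      (∀ a : A, Δext (a : 𝓜(ℂ, A)) = Δ a) ∧ Δext 1 = E := by
  have hL (x : D) : E.fst x ∈
      closure (Submodule.span ℂ {y : D | ∃ (a : A) (x : D), (Δ a).fst x = y} : Set D) :=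
    hE_left ▸ ⟨x, rfl⟩
  have hR (x : D) : E.snd x ∈
      closure (Submodule.span ℂ {y : D | ∃ (a : A) (x : D), (Δ a).snd x = y} : Set D) :=
    hE_right ▸ ⟨x, rfl⟩
  have hEΔ (a : A) : E * Δ a = Δ a := by
    refine ext_fst fun x ↦ ?_
    obtain ⟨z, hz⟩ := hE_left.subset (subset_closure (Submodule.subset_span ⟨a, x, rfl⟩))
    change E.fst ((Δ a).fst x) = _
    rw [← hz]
    exact congrArg (fun T ↦ T.fst z) hE_idem
  have hΔE (a : A) : Δ a * E = Δ a := by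
    refine ext_snd fun x ↦ ?_
    obtain ⟨z, hz⟩ := hE_right.subset (subset_closure (Submodule.subset_span ⟨a, x, rfl⟩))
    change E.snd ((Δ a).snd x) = _
    rw [← hz]
    exact congrArg (fun T ↦ T.snd z) hE_idem
  choose T hTΔ hΔT hTE hET using exists_extension_apply hEΔ hΔE hL hR
  have hunique {m : 𝓜(ℂ, A)} {S : 𝓜(ℂ, D)} (hS : S * E = S)
      (h : ∀ a, S * Δ a = Δ (m.fst a)) : T m = S :=
    eq_of_mul_apply_eq hL (hTE m) hS fun a ↦ by rw [hTΔ, h]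
  refine ⟨{ toFun := T, map_smul' := fun c m ↦ ?_, map_zero' := ?_, map_add' := fun m n ↦ ?_,
            map_mul' := fun m n ↦ ?_, map_star' := fun m ↦ ?_ }, fun a ↦ ?_, ?_⟩
  · exact hunique (by simp [hTE]) fun a ↦ by simp [hTΔ]
  · exact hunique (by simp) fun a ↦ by simp
  · exact hunique (by simp [add_mul, hTE]) fun a ↦ by simp [add_mul, hTΔ]
  · exact hunique (by rw [mul_assoc, hTE]) fun a ↦ by simp [mul_assoc, hTΔ]
  · refine hunique ?_ fun a ↦ ?_
    · rw [← hE_star, ← star_mul, hET]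
    · rw [star_fst, map_star, ← hΔT, star_mul, map_star, star_star]
  · exact hunique (hΔE a) fun b ↦ by simp
  · exact hunique hE_idem fun a ↦ by simp [hEΔ]
end

section
/- For every m ∈ M(A), if a₁, …, a_N ∈ A and z₁, …, z_N ∈ D satisfy Σᵢ Δ(aᵢ)·zᵢ = 0 in D, then Σᵢ Δ(m•aᵢ)·zᵢ = 0, where m•aᵢ ∈ A denotes the action of the multiplier m on aᵢ. Consequently, the assignment Σᵢ Δ(aᵢ)·zᵢ ↦ Σᵢ Δ(m•aᵢ)·zᵢ is a well-defined linear map on the linear span of Δ(A)·D. (Key well-definedness claim in the proof of Proposition 3.3(4) of the paper.) -/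
open scoped MultiplierAlgebra

theorem DoubleCentralizer.star_fst_mul {D : Type*} [NonUnitalCStarAlgebra D]
    (T : 𝓜(ℂ, D)) (z y : D) : star (T.fst z) * y = star z * (star T).fst y := by
  rw [← (star T).central, DoubleCentralizer.star_snd, star_star]

/-- Key well-definedness claim in the proof of Proposition 3.3(4): for `m ∈ M(A)`,
if `Σᵢ Δ(aᵢ)·zᵢ = 0` in `D`, then `Σᵢ Δ(m•aᵢ)·zᵢ = 0`. -/
theorem extension_well_defined
    {A D : Type*} [NonUnitalCStarAlgebra A] [NonUnitalCStarAlgebra D]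
    (Δ : A →⋆ₙₐ[ℂ] 𝓜(ℂ, D)) (E : 𝓜(ℂ, D))
    (hE_star : star E = E) (hE_idem : E * E = E)
    (hE_left : closure (Submodule.span ℂ {y : D | ∃ (a : A) (x : D), (Δ a).fst x = y} : Set D)
      = {y : D | ∃ x : D, E.fst x = y})
    (hE_right : closure (Submodule.span ℂ {y : D | ∃ (a : A) (x : D), (Δ a).snd x = y} : Set D)
      = {y : D | ∃ x : D, E.snd x = y})
    (m : 𝓜(ℂ, A)) :
    ∀ (N : ℕ) (a : Fin N → A) (z : Fin N → D),
      (∑ i, (Δ (a i)).fst (z i)) = 0 → (∑ i, (Δ (m.fst (a i))).fst (z i)) = 0 := by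
  intro N a z h
  have annihilated (e : A) : (Δ e).fst (∑ i, (Δ (m.fst (a i))).fst (z i)) = 0 := by
    calc
      _ = ∑ i, (Δ (m.snd e)).fst ((Δ (a i)).fst (z i)) := by
        rw [map_sum]
        refine Finset.sum_congr rfl fun i _ => ?_
        rw [← mul_apply_eq_comp, ← DoubleCentralizer.mul_fst, ← map_mul,
          ← m.central, map_mul, DoubleCentralizer.mul_fst, mul_apply_eq_comp]
      _ = 0 := by rw [← map_sum, h, map_zero]
  rw [← CStarRing.star_mul_self_eq_zero_iff]
  nth_rewrite 1 [star_sum]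
  rw [Finset.sum_mul]
  refine Finset.sum_eq_zero fun i _ => ?_
  rw [DoubleCentralizer.star_fst_mul, ← map_star, annihilated, mul_zero]
end
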